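/- arXiv:1804.06753 — 4 statements merged into one kernel-verified Lean document; each statement's English description precedes it below -/
import Mathlib

section
/- Acausal Gronwall inequality: Let r ∈ (0,1) and let K ≥ 4 be an integer. Suppose (b_k)_{k≥0} is a bounded sequence of non-negative real numbers and (x_k)_{k≥0} is a sequence of non-negative real numbers satisfying x_k ≤ b_k for 0 ≤ k < K, and x_k ≤ b_k + Σ_{ℓ=0}^{k−K} r^{k−ℓ} x_ℓ for k ≥ K. Then there exists a constant C > 0, depending only on r and K, such that for every k ≥ 0, x_k ≤ C · Σ_{ℓ=0}^{k} r^{k−ℓ} · exp( (log(K−1)/(K−1)) · (k−ℓ) ) · b_ℓ. -/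
/-- The geometric convolution `∑_{ℓ ≤ k} p ^ (k - ℓ) b_ℓ`. -/
noncomputable def geomConv (p : ℝ) (b : ℕ → ℝ) (k : ℕ) : ℝ :=
  ∑ ℓ ∈ Finset.range (k + 1), p ^ (k - ℓ) * b ℓ

theorem geomConv_succ (p : ℝ) (b : ℕ → ℝ) (k : ℕ) :
    geomConv p b (k + 1) = p * geomConv p b k + b (k + 1) := by
  unfold geomConv
  rw [Finset.sum_range_succ, Finset.mul_sum]
  congr 1
  · refine Finset.sum_congr rfl fun ℓ hℓ => ?_
    rw [Nat.succ_sub (Finset.mem_range_succ_iff.1 hℓ), pow_succ]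
    ring
  · simp

theorem geomConv_nonneg {p : ℝ} (hp : 0 ≤ p) {b : ℕ → ℝ} (hb : ∀ k, 0 ≤ b k) (k : ℕ) :
    0 ≤ geomConv p b k :=
  Finset.sum_nonneg fun ℓ _ => mul_nonneg (pow_nonneg hp _) (hb ℓ)

theorem le_geomConv {p : ℝ} (hp : 0 ≤ p) {b : ℕ → ℝ} (hb : ∀ k, 0 ≤ b k) (k : ℕ) :
    b k ≤ geomConv p b k := by
  cases k with
  | zero => simp [geomConv]
  | succ k =>
    rw [geomConv_succ]
    exact le_add_of_nonneg_left (mul_nonneg hp (geomConv_nonneg hp hb k))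

theorem pow_mul_geomConv_le {p : ℝ} (hp : 0 ≤ p) {b : ℕ → ℝ} (hb : ∀ k, 0 ≤ b k) (n m : ℕ) :
    p ^ m * geomConv p b n ≤ geomConv p b (n + m) := by
  induction m with
  | zero => simp
  | succ m ih =>
    rw [← add_assoc, geomConv_succ, pow_succ']
    nlinarith [mul_le_mul_of_nonneg_left ih hp, hb (n + m + 1)]

theorem geomConv_geomConv_le {r q : ℝ} (hr : 0 ≤ r) (hq : 1 ≤ q) {K : ℕ}
    (hK : 1 ≤ q ^ K * (q - 1)) {b : ℕ → ℝ} (hb : ∀ k, 0 ≤ b k) (n : ℕ) :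
    geomConv r (geomConv (r * q) b) n ≤ q ^ (K + 1) * geomConv (r * q) b n := by
  have hp : 0 ≤ r * q := by positivity
  have hqK : 1 ≤ q ^ (K + 1) := one_le_pow₀ hq
  induction n with
  | zero =>
    simpa [geomConv] using le_mul_of_one_le_left (hb 0) hqK
  | succ n ih =>
    have hT := geomConv_nonneg hp hb n
    have hstep : r * q * geomConv (r * q) b n ≤ geomConv (r * q) b (n + 1) := by
      rw [geomConv_succ]
      exact le_add_of_nonneg_right (hb _)
    have h₁ := mul_le_mul_of_nonneg_left ih hr
    have h₂ := mul_le_mul_of_nonneg_left hstep (sub_nonneg.2 hqK)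
    have h₃ : 0 ≤ (q ^ K * (q - 1) - 1) * (r * q * geomConv (r * q) b n) :=
      mul_nonneg (sub_nonneg.2 hK) (mul_nonneg hp hT)
    rw [geomConv_succ r]
    rw [pow_succ] at *
    linarith

/-- A delayed discrete Gronwall inequality with geometric kernel. -/
theorem le_geomConv_of_delayed_le {r q : ℝ} (hr : 0 ≤ r) (hq : 1 ≤ q) {K : ℕ}
    (hK : 1 ≤ q ^ K * (q - 1)) {b x : ℕ → ℝ} (hb : ∀ k, 0 ≤ b k)
    (hx : ∀ k < K + 1, x k ≤ b k)
    (hxK : ∀ n, x (n + (K + 1)) ≤ b (n + (K + 1)) + r ^ (K + 1) * geomConv r x n) (k : ℕ) :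
    x k ≤ geomConv (r * q) b k := by
  have hp : 0 ≤ r * q := by positivity
  induction k using Nat.strong_induction_on with
  | _ k ih =>
    rcases lt_or_ge k (K + 1) with hk | hk
    · exact (hx k hk).trans (le_geomConv hp hb k)
    · obtain ⟨n, rfl⟩ := Nat.exists_eq_add_of_le' hk
      have h₁ : geomConv r x n ≤ geomConv r (geomConv (r * q) b) n := by
        refine Finset.sum_le_sum fun ℓ hℓ => ?_
        have := Finset.mem_range.1 hℓ
        exact mul_le_mul_of_nonneg_left (ih ℓ (by omega)) (pow_nonneg hr _)
      have h₂ := mul_le_mul_of_nonneg_left (h₁.trans (geomConv_geomConv_le hr hq hK hb n))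
        (pow_nonneg hr (K + 1))
      have h₃ := mul_le_mul_of_nonneg_left (pow_mul_geomConv_le hp hb n K) hp
      have h₄ := hxK n
      rw [← add_assoc, geomConv_succ]
      rw [← add_assoc] at h₄
      have h₅ : r ^ (K + 1) * (q ^ (K + 1) * geomConv (r * q) b n)
          = r * q * ((r * q) ^ K * geomConv (r * q) b n) := by ring
      linarith

theorem one_le_exp_log_div_pow_mul {K : ℕ} (hK : 3 ≤ K) :
    1 ≤ Real.exp (Real.log K / K) ^ K * (Real.exp (Real.log K / K) - 1) := by
  have hK3 : (3 : ℝ) ≤ K := by exact_mod_cast hK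
  have hK0 : (0 : ℝ) < K := by linarith
  have hpow : Real.exp (Real.log K / K) ^ K = K := by
    rw [← Real.exp_nat_mul, mul_div_cancel₀ _ hK0.ne', Real.exp_log hK0]
  have hlog : 1 ≤ Real.log K := by
    rw [Real.le_log_iff_exp_le hK0]
    linarith [Real.exp_one_lt_d9]
  have hexp := Real.add_one_le_exp (Real.log K / K)
  rw [hpow]
  calc 1 ≤ Real.log K := hlog
    _ = K * (Real.log K / K) := (mul_div_cancel₀ _ hK0.ne').symm
    _ ≤ _ := mul_le_mul_of_nonneg_left (by linarith) hK0.le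

/-- Acausal Gronwall inequality (Killip–Masaki–Murphy–Visan, Lemma 2.1). -/
theorem acausal_gronwall (r : ℝ) (hr0 : 0 < r) (hr1 : r < 1) (K : ℕ) (hK : 4 ≤ K) :
    ∃ C : ℝ, 0 < C ∧ ∀ (b x : ℕ → ℝ),
      (∀ k, 0 ≤ b k) → BddAbove (Set.range b) →
      (∀ k, 0 ≤ x k) →
      (∀ k < K, x k ≤ b k) →
      (∀ k, K ≤ k → x k ≤ b k + ∑ ℓ ∈ Finset.range (k - K + 1), r ^ (k - ℓ) * x ℓ) →
      ∀ k, x k ≤ C * ∑ ℓ ∈ Finset.range (k + 1),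
        r ^ (k - ℓ) * Real.exp (Real.log ((K : ℝ) - 1) / ((K : ℝ) - 1) * ((k : ℝ) - (ℓ : ℝ))) * b ℓ := by
  refine ⟨1, one_pos, fun b x hb _ _ hx hxK k => ?_⟩
  obtain ⟨J, rfl⟩ := Nat.exists_eq_add_of_le' (show 1 ≤ K by omega)
  have hJ : ((J + 1 : ℕ) : ℝ) - 1 = J := by push_cast; ring
  have hq : 1 ≤ Real.exp (Real.log J / J) :=
    Real.one_le_exp (div_nonneg (Real.log_natCast_nonneg J) J.cast_nonneg)
  have key := le_geomConv_of_delayed_le hr0.le hq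
    (one_le_exp_log_div_pow_mul (show 3 ≤ J by omega)) hb hx (fun n => ?_) k
  · rw [one_mul, hJ]
    refine key.trans_eq (Finset.sum_congr rfl fun ℓ hℓ => ?_)
    rw [mul_pow, ← Real.exp_nat_mul, Nat.cast_sub (Finset.mem_range_succ_iff.1 hℓ),
      mul_comm ((k : ℝ) - ℓ)]
  · refine (hxK (n + (J + 1)) (Nat.le_add_left _ _)).trans_eq ?_
    rw [Nat.add_sub_cancel, geomConv, Finset.mul_sum]
    congr 1
    refine Finset.sum_congr rfl fun ℓ hℓ => ?_
    rw [Nat.sub_add_comm (Finset.mem_range_succ_iff.1 hℓ), pow_add]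
    ring
end

section
/- Let d ≥ 3 be an integer, let 4/(d+1) < p < 4/d, and set s_c = d/2 − 2/p. Then max{ 1/(p+1), 1/2 − s_c, 4/(p(d+2)) } < min{ 1, (2/3)·(1/(p+1))·(5/2 − s_c) }. Consequently, there exists a real number q > 2 such that max{ 1/(p+1), 1/2 − s_c, 4/(p(d+2)) } < 2/q < min{ 1, (2/3)·(1/(p+1))·(5/2 − s_c) }. -/
/-- The exponent `q` defining the scattering norm can be chosen:
for `4/(d+1) < p < 4/d` and `s_c = d/2 − 2/p`, one has
`max{1/(p+1), 1/2 − s_c, 4/(p(d+2))} < min{1, (2/3)(1/(p+1))(5/2 − s_c)}`,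
and hence some `q > 2` with `2/q` strictly between these two quantities. -/
theorem exists_scattering_exponent (d : ℕ) (hd : 3 ≤ d) (p : ℝ)
    (hp1 : 4/((d : ℝ)+1) < p) (hp2 : p < 4/(d : ℝ)) :
    max (max (1/(p+1)) (1/2 - ((d : ℝ)/2 - 2/p))) (4/(p*((d : ℝ)+2)))
      < min 1 ((2/3) * (1/(p+1)) * (5/2 - ((d : ℝ)/2 - 2/p))) ∧
    ∃ q : ℝ, 2 < q ∧
      max (max (1/(p+1)) (1/2 - ((d : ℝ)/2 - 2/p))) (4/(p*((d : ℝ)+2))) < 2/q ∧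
      2/q < min 1 ((2/3) * (1/(p+1)) * (5/2 - ((d : ℝ)/2 - 2/p))) := by
  have hd' : (3 : ℝ) ≤ d := by exact_mod_cast hd
  have hp : 0 < p := lt_trans (by positivity) hp1
  -- In terms of `x = -2 s_c`, the assumption on `p` reads `0 < x < 1`.
  obtain ⟨x, hx⟩ : ∃ x : ℝ, x = 4/p - d := ⟨_, rfl⟩
  have hpx : p * (d + x) = 4 := by rw [hx]; field_simp; ring
  have hs : (d : ℝ)/2 - 2/p = -(x/2) := by rw [hx]; ring
  have hx0 : 0 < x := by
    rw [lt_div_iff₀ (by positivity)] at hp2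
    nlinarith
  have hx1 : x < 1 := by
    rw [div_lt_iff₀ (by positivity)] at hp1
    nlinarith
  have hpe : p = 4/(d + x) := by rw [eq_div_iff (by positivity)]; exact hpx
  have hrhs : (2/3) * (1/(p+1)) * (5/2 - -(x/2)) = (5 + x)/(3*(p+1)) := by field_simp; ring
  have key : max (max (1/(p+1)) (1/2 - ((d : ℝ)/2 - 2/p))) (4/(p*((d : ℝ)+2)))
      < min 1 ((2/3) * (1/(p+1)) * (5/2 - ((d : ℝ)/2 - 2/p))) := by
    rw [hs, hrhs]
    refine lt_min (max_lt (max_lt ?_ ?_) ?_) (max_lt (max_lt ?_ ?_) ?_)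
    · rw [div_lt_one (by positivity)]; linarith
    · linarith
    · rw [div_lt_one (by positivity)]; nlinarith
    · rw [div_lt_div_iff₀ (by positivity) (by positivity)]; nlinarith
    · have hp3 : p ≤ 4/(3 + x) := by rw [hpe]; gcongr
      have hp3' : p * (3 + x) ≤ 4 := (le_div_iff₀ (by positivity)).mp hp3
      rw [lt_div_iff₀ (by positivity)]
      have h : 0 < (1 - x) * (x + 9) := mul_pos (by linarith) (by linarith)
      nlinarith
    · rw [div_lt_div_iff₀ (by positivity) (by positivity)]
      have h : 0 < p * (2*d - 2 + (d - 1)*x) := by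
        have : 0 < ((d : ℝ) - 1) * x := mul_pos (by linarith) hx0
        exact mul_pos hp (by linarith)
      nlinarith
  refine ⟨key, ?_⟩
  obtain ⟨r, hr1, hr2⟩ := exists_between key
  have hr0 : 0 < r := by
    have h : 1/(p+1) < r := ((le_max_left _ _).trans (le_max_left _ _)).trans_lt hr1
    exact lt_trans (by positivity) h
  have hr : r < 1 := hr2.trans_le (min_le_left _ _)
  have hq : 2/(2/r) = r := by field_simp
  refine ⟨2/r, ?_, by rwa [hq], by rwa [hq]⟩
  rw [lt_div_iff₀ hr0]
  linarith
end

section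
/- Let d ≥ 3 be an integer and define p₀(d) = (15 − 2d + √(4d² + 100d + 145)) / (5(2d−1)) if 3 ≤ d ≤ 8, and p₀(d) = 4/(d+1) if d ≥ 9. Suppose p₀(d) < p < 4/d. Then 8 − p(2d−1) > 0, 8 − p(2d−5) > 0, and max{ 2, (6/5)(p+1), 10p(p+1)/(8 − p(2d−5)) } < min{ 6p/(8 − p(2d−1)), 2(p+1), 6 }. In particular, there exists a real number r₁ strictly between these two quantities. -/
/-- A number above the larger root of a quadratic with positive leading coefficient makes the
quadratic positive. -/
theorem quadratic_pos_of_larger_root_lt {a b c p : ℝ} (ha : 0 < a)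
    (h : (b + √(b ^ 2 + a * c)) / a < p) : 0 < a * p ^ 2 - 2 * b * p - c := by
  rw [div_lt_iff₀ ha] at h
  have hs : √(b ^ 2 + a * c) < p * a - b := by linarith
  have hsq := Real.lt_sq_of_sqrt_lt hs
  have : 0 < a * (a * p ^ 2 - 2 * b * p - c) := by nlinarith
  exact pos_of_mul_pos_right this ha.le

/-- The threshold makes the dyadic summation quadratic positive and dominates `4 / (d + 1)`. -/
theorem summation_quadratic_pos_of_threshold_lt {d : ℕ} (hd : 3 ≤ d) {p : ℝ}
    (h : (if d ≤ 8 then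
        (15 - 2*(d : ℝ) + Real.sqrt (4*(d : ℝ)^2 + 100*(d : ℝ) + 145)) / (5*(2*(d : ℝ)-1))
      else 4/((d : ℝ)+1)) < p) :
    0 < 5*(2*(d : ℝ)-1) * p ^ 2 - 2 * (15 - 2*(d : ℝ)) * p - 16 ∧ 4 < p * ((d : ℝ) + 1) := by
  have hdR : (3 : ℝ) ≤ d := by exact_mod_cast hd
  split_ifs at h with h8
  · have ha : 0 < 5*(2*(d : ℝ)-1) := by linarith
    have hp : 0 < p := by
      refine lt_of_le_of_lt (div_nonneg ?_ ha.le) h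
      have : 2*(d : ℝ) - 15 ≤ Real.sqrt (4*(d : ℝ)^2 + 100*(d : ℝ) + 145) :=
        Real.le_sqrt_of_sq_le (by nlinarith)
      linarith
    have hq : 0 < 5*(2*(d : ℝ)-1) * p ^ 2 - 2 * (15 - 2*(d : ℝ)) * p - 16 := by
      apply quadratic_pos_of_larger_root_lt ha
      convert h using 4
      ring
    refine ⟨hq, ?_⟩
    clear h
    by_contra! hle
    interval_cases d <;> norm_num at hq hle <;> nlinarith
  · have h9 : (9 : ℝ) ≤ d := by exact_mod_cast (by omega : 9 ≤ d)
    rw [div_lt_iff₀ (by linarith)] at h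
    refine ⟨?_, h⟩
    have hp : 0 < p := by
      by_contra! hle
      nlinarith
    have h1 : 0 < p * (5*(2*(d : ℝ)-1)) := by apply mul_pos hp; linarith
    have h2 : 0 < (p * ((d : ℝ) + 1) - 4) * (p * (5*(2*(d : ℝ)-1))) := mul_pos (by linarith) h1
    have h3 : 0 < (p * ((d : ℝ) + 1) - 4) * (2 * (d : ℝ)^2 - 6 * d - 10) := by
      apply mul_pos (by linarith); nlinarith
    have h4 : 0 < ((d : ℝ) + 1) *
        (5*(2*(d : ℝ)-1) * p ^ 2 - 2 * (15 - 2*(d : ℝ)) * p - 16) := by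
      nlinarith
    exact pos_of_mul_pos_right h4 (by linarith)

/-- For `p₀(d) < p < 4/d`, where `p₀(d)` is the threshold of the paper,
an exponent `r₁` can be chosen satisfying simultaneously the admissibility
constraints and the dyadic summation constraint. -/
theorem exists_r1_above_threshold (d : ℕ) (hd : 3 ≤ d) (p : ℝ)
    (hp1 : (if d ≤ 8 then
        (15 - 2*(d : ℝ) + Real.sqrt (4*(d : ℝ)^2 + 100*(d : ℝ) + 145)) / (5*(2*(d : ℝ)-1))
      else 4/((d : ℝ)+1)) < p)
    (hp2 : p < 4/(d : ℝ)) :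
    0 < 8 - p*(2*(d : ℝ)-1) ∧ 0 < 8 - p*(2*(d : ℝ)-5) ∧
    max (max 2 ((6/5)*(p+1))) (10*p*(p+1)/(8 - p*(2*(d : ℝ)-5)))
      < min (min (6*p/(8 - p*(2*(d : ℝ)-1))) (2*(p+1))) 6 ∧
    ∃ r₁ : ℝ,
      max (max 2 ((6/5)*(p+1))) (10*p*(p+1)/(8 - p*(2*(d : ℝ)-5))) < r₁ ∧
      r₁ < min (min (6*p/(8 - p*(2*(d : ℝ)-1))) (2*(p+1))) 6 := by
  have hdR : (3 : ℝ) ≤ d := by exact_mod_cast hd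
  obtain ⟨hq, hl⟩ := summation_quadratic_pos_of_threshold_lt hd hp1
  rw [lt_div_iff₀ (by linarith)] at hp2
  have hp : 0 < p := by
    by_contra! hle
    nlinarith
  have hp43 : p < 4 / 3 := by nlinarith
  have hA : 0 < 8 - p*(2*(d : ℝ)-1) := by linarith
  have hB : 0 < 8 - p*(2*(d : ℝ)-5) := by linarith
  have hr : 0 < (2*(d : ℝ)-1) * p ^ 2 + (2*(d : ℝ)-4) * p - 8 := by
    by_cases h4 : d ≤ 4
    · clear hp1
      interval_cases d <;> norm_num at * <;> nlinarith
    · have h5 : (5 : ℝ) ≤ d := by exact_mod_cast (by omega : 5 ≤ d)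
      nlinarith [mul_pos hp hp, mul_pos hp (sub_pos.2 hl)]
  have key : max (max 2 ((6/5)*(p+1))) (10*p*(p+1)/(8 - p*(2*(d : ℝ)-5)))
      < min (min (6*p/(8 - p*(2*(d : ℝ)-1))) (2*(p+1))) 6 := by
    simp only [max_lt_iff, lt_min_iff]
    refine ⟨⟨⟨⟨?_, ?_⟩, ?_⟩, ⟨?_, ?_⟩, ?_⟩, ⟨?_, ?_⟩, ?_⟩
    · rw [lt_div_iff₀ hA]; linarith
    · rw [lt_div_iff₀ hA]; linarith
    · rw [div_lt_div_iff₀ hB hA]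
      linarith [mul_pos hp hq]
    · linarith
    · linarith
    · rw [div_lt_iff₀ hB]
      have : 0 < (p + 1) * (4 - p * d) := mul_pos (by linarith) (by linarith)
      linarith
    · norm_num
    · linarith
    · rw [div_lt_iff₀ hB]; nlinarith
  exact ⟨hA, hB, key, exists_between key⟩
end

section
/- Let d ≥ 3 be an integer and define p₀(d) = (15 − 2d + √(4d² + 100d + 145)) / (5(2d−1)) if 3 ≤ d ≤ 8, and p₀(d) = 4/(d+1) if d ≥ 9. Suppose p₀(d) < p < 4/d. Then max{ (4 − p(d−2))/(p(d+2)), (−p²(d−1) − p(d−3) + 4)/(2p) } < min{ p, (d−1)/d }. In particular, there exists a real number r with max{ (4 − p(d−2))/(p(d+2)), (−p²(d−1) − p(d−3) + 4)/(2p) } < 2/r < min{ p, (d−1)/d }. -/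
/-- The lower threshold on `p` is at least `4/(d+1)`, and above it the quadratic
`d(d-1)p² + (d-2)(d+1)p - 4d` is positive. -/
lemma tail_exponent_lower_bounds (d : ℕ) (hd : 3 ≤ d) (p : ℝ)
    (hp : (if d ≤ 8 then
        (15 - 2*(d : ℝ) + Real.sqrt (4*(d : ℝ)^2 + 100*(d : ℝ) + 145)) / (5*(2*(d : ℝ)-1))
      else 4/((d : ℝ)+1)) < p) :
    4 < p * ((d : ℝ) + 1) ∧
      0 < (d : ℝ)*((d : ℝ)-1)*p^2 + ((d : ℝ)-2)*((d : ℝ)+1)*p - 4*(d : ℝ) := by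
  have hd3 : (3 : ℝ) ≤ d := by exact_mod_cast hd
  have quadratic_pos (hd5 : (5 : ℝ) ≤ d) (hp4 : 4 < p * ((d : ℝ) + 1)) :
      0 < (d : ℝ)*((d : ℝ)-1)*p^2 + ((d : ℝ)-2)*((d : ℝ)+1)*p - 4*(d : ℝ) := by
    have h1 : 16 < (p * ((d : ℝ) + 1))^2 := by nlinarith
    have h2 : 8 * ((d : ℝ) + 1)^2 < (d : ℝ)*((d : ℝ)-1) * (p * ((d : ℝ) + 1))^2 := by
      nlinarith [mul_lt_mul_of_pos_left h1 (show 0 < (d : ℝ)*((d : ℝ)-1) by nlinarith)]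
    have h3 : 8 < (d : ℝ)*((d : ℝ)-1)*p^2 := by
      have : 0 < ((d : ℝ) + 1)^2 := by positivity
      nlinarith
    nlinarith
  split_ifs at hp with h8
  · rw [div_lt_iff₀ (by linarith)] at hp
    interval_cases d
    · have hs : (21 : ℝ) < √(4*((3 : ℕ) : ℝ)^2 + 100*((3 : ℕ) : ℝ) + 145) :=
        Real.lt_sqrt_of_sq_lt (by norm_num)
      have hb : 6/5 < p := by push_cast at hp hs; linarith
      constructor <;> push_cast <;> nlinarith
    · have hs : (24 : ℝ) < √(4*((4 : ℕ) : ℝ)^2 + 100*((4 : ℕ) : ℝ) + 145) :=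
        Real.lt_sqrt_of_sq_lt (by norm_num)
      have hb : 31/35 < p := by push_cast at hp hs; linarith
      constructor <;> push_cast <;> nlinarith
    · have hs : (27 : ℝ) < √(4*((5 : ℕ) : ℝ)^2 + 100*((5 : ℕ) : ℝ) + 145) :=
        Real.lt_sqrt_of_sq_lt (by norm_num)
      have hp4 : 4 < p * (((5 : ℕ) : ℝ) + 1) := by push_cast at hp hs ⊢; linarith
      exact ⟨hp4, quadratic_pos (by norm_num) hp4⟩
    · have hs : (29 : ℝ) < √(4*((6 : ℕ) : ℝ)^2 + 100*((6 : ℕ) : ℝ) + 145) :=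
        Real.lt_sqrt_of_sq_lt (by norm_num)
      have hp4 : 4 < p * (((6 : ℕ) : ℝ) + 1) := by push_cast at hp hs ⊢; linarith
      exact ⟨hp4, quadratic_pos (by norm_num) hp4⟩
    · have hs : (32 : ℝ) < √(4*((7 : ℕ) : ℝ)^2 + 100*((7 : ℕ) : ℝ) + 145) :=
        Real.lt_sqrt_of_sq_lt (by norm_num)
      have hp4 : 4 < p * (((7 : ℕ) : ℝ) + 1) := by push_cast at hp hs ⊢; linarith
      exact ⟨hp4, quadratic_pos (by norm_num) hp4⟩
    · have hs : (69/2 : ℝ) < √(4*((8 : ℕ) : ℝ)^2 + 100*((8 : ℕ) : ℝ) + 145) :=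
        Real.lt_sqrt_of_sq_lt (by norm_num)
      have hp4 : 4 < p * (((8 : ℕ) : ℝ) + 1) := by norm_num at hp hs ⊢; linarith
      exact ⟨hp4, quadratic_pos (by norm_num) hp4⟩
  · have hp4 : 4 < p * ((d : ℝ) + 1) := (div_lt_iff₀ (by linarith)).1 hp
    have hd5 : (5 : ℝ) ≤ d := by exact_mod_cast (by omega : 5 ≤ d)
    exact ⟨hp4, quadratic_pos hd5 hp4⟩


/-- Exponent choice in the tail estimate: for `p₀(d) < p < 4/d`, one has
`max{(4 − p(d−2))/(p(d+2)), (−p²(d−1) − p(d−3) + 4)/(2p)} < min{p, (d−1)/d}`,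
hence an `r` with `2/r` strictly between these quantities exists. -/
theorem exists_tail_exponent (d : ℕ) (hd : 3 ≤ d) (p : ℝ)
    (hp1 : (if d ≤ 8 then
        (15 - 2*(d : ℝ) + Real.sqrt (4*(d : ℝ)^2 + 100*(d : ℝ) + 145)) / (5*(2*(d : ℝ)-1))
      else 4/((d : ℝ)+1)) < p)
    (hp2 : p < 4/(d : ℝ)) :
    max ((4 - p*((d : ℝ)-2))/(p*((d : ℝ)+2))) ((-p^2*((d : ℝ)-1) - p*((d : ℝ)-3) + 4)/(2*p))
      < min p (((d : ℝ)-1)/(d : ℝ)) ∧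
    ∃ r : ℝ,
      max ((4 - p*((d : ℝ)-2))/(p*((d : ℝ)+2))) ((-p^2*((d : ℝ)-1) - p*((d : ℝ)-3) + 4)/(2*p))
        < 2/r ∧
      2/r < min p (((d : ℝ)-1)/(d : ℝ)) := by
  obtain ⟨hp4, hquad⟩ := tail_exponent_lower_bounds d hd p hp1
  have hd3 : (3 : ℝ) ≤ d := by exact_mod_cast hd
  have hp : 0 < p := by
    by_contra! h
    nlinarith
  have key : max ((4 - p*((d : ℝ)-2))/(p*((d : ℝ)+2)))
      ((-p^2*((d : ℝ)-1) - p*((d : ℝ)-3) + 4)/(2*p)) < min p (((d : ℝ)-1)/(d : ℝ)) := by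
    have hd0 : (0 : ℝ) < d := by linarith
    have hpd : 0 < p * ((d : ℝ) + 2) := by positivity
    refine max_lt (lt_min ?_ ?_) (lt_min ?_ ?_)
    · rw [div_lt_iff₀ hpd]
      nlinarith [mul_pos (by linarith : 0 < p + 1) (by linarith : 0 < p * ((d : ℝ) + 2) - 4)]
    · rw [div_lt_div_iff₀ hpd hd0]
      nlinarith [mul_pos hp (by nlinarith : 0 < (d : ℝ)^2 - 2*d - 2)]
    · rw [div_lt_iff₀ (by positivity)]
      nlinarith [mul_pos (by linarith : 0 < p + 1) (by linarith : 0 < p * ((d : ℝ) + 1) - 4)]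
    · rw [div_lt_div_iff₀ (by positivity) hd0]
      nlinarith
  obtain ⟨m, hm₁, hm₂⟩ := exists_between key
  exact ⟨key, 2 / m, by rwa [div_div_cancel₀ two_ne_zero], by rwa [div_div_cancel₀ two_ne_zero]⟩
end
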